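/- Let n ≥ 2, 0 < p, q ≤ ∞, s_p = (n−1)(1/min(p,1) − 1), and s < s_p. There exists a constant C > 0 such that for every Schwartz function f ∈ 𝒮(ℝⁿ), ‖Tr f‖_{B^{s}_{p,q}(ℝ^{n−1})} ≤ C ‖f‖_{B^{s_p + 1/p}_{p, min(p,q,1)}(ℝⁿ)}. -/

import Mathlib

open MeasureTheory FourierTransform
open scoped ENNReal NNReal

noncomputable section

/-- `η` is an admissible bump function: smooth, valued in `[0,1]`, equal to `1` on `|t| ≤ 1`
and vanishing for `|t| ≥ 2`. -/
def IsBump (η : ℝ → ℝ) : Prop :=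
  ContDiff ℝ (⊤ : ℕ∞) η ∧ (∀ t, η t ∈ Set.Icc (0:ℝ) 1) ∧ (∀ t, |t| ≤ 1 → η t = 1) ∧
    (∀ t, 2 ≤ |t| → η t = 0)

/-- The Littlewood–Paley pieces: `φ_0(ξ) = η(|ξ|)`,
`φ_j(ξ) = η(2^{-j}|ξ|) - η(2^{-j+1}|ξ|)` for `j ≥ 1`. -/
def littlewood (η : ℝ → ℝ) {d : ℕ} (j : ℕ) (ξ : EuclideanSpace ℝ (Fin d)) : ℝ :=
  if j = 0 then η ‖ξ‖
  else η ((2:ℝ) ^ (-(j:ℝ)) * ‖ξ‖) - η ((2:ℝ) ^ (-(j:ℝ) + 1) * ‖ξ‖)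

/-- The dyadic decomposition operator `Δ_j f = 𝓕⁻¹(φ_j 𝓕 f)`. -/
def dyadicBox (η : ℝ → ℝ) {d : ℕ} (j : ℕ) (f : EuclideanSpace ℝ (Fin d) → ℂ) :
    EuclideanSpace ℝ (Fin d) → ℂ :=
  𝓕⁻ (fun ξ => (littlewood η j ξ : ℂ) * 𝓕 f ξ)

/-- The `ℓ^q` combination of a family of extended nonnegative reals, with the supremum
modification for `q = ∞`. -/
def lqSum {ι : Type*} (q : ℝ≥0∞) (a : ι → ℝ≥0∞) : ℝ≥0∞ :=
  if q = ∞ then ⨆ i, a i else (∑' i, a i ^ q.toReal) ^ (1 / q.toReal)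

/-- The Besov quasi-norm `‖f‖_{B^s_{p,q}(ℝ^d)} = (Σ_j 2^{jsq} ‖Δ_j f‖_p^q)^{1/q}`. -/
def besovNorm (η : ℝ → ℝ) {d : ℕ} (s : ℝ) (p q : ℝ≥0∞)
    (f : EuclideanSpace ℝ (Fin d) → ℂ) : ℝ≥0∞ :=
  lqSum q (fun j : ℕ =>
    ENNReal.ofReal ((2:ℝ) ^ ((j:ℝ) * s)) * eLpNorm (dyadicBox η j f) p volume)

/-- The logarithmically weighted Besov quasi-norm
`‖f‖_{B̃^s_{p,q}(ℝ^d)} = (Σ_j (1+j) 2^{jsq} ‖Δ_j f‖_p^q)^{1/q}`. -/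
def besovNormLog (η : ℝ → ℝ) {d : ℕ} (s : ℝ) (p q : ℝ≥0∞)
    (f : EuclideanSpace ℝ (Fin d) → ℂ) : ℝ≥0∞ :=
  if q = ∞ then
    ⨆ j : ℕ, ENNReal.ofReal ((2:ℝ) ^ ((j:ℝ) * s)) * eLpNorm (dyadicBox η j f) p volume
  else
    (∑' j : ℕ, (1 + (j:ℝ≥0∞)) *
        (ENNReal.ofReal ((2:ℝ) ^ ((j:ℝ) * s)) *
          eLpNorm (dyadicBox η j f) p volume) ^ q.toReal) ^ (1 / q.toReal)

/-- The trace `(Tr f)(x̄) = f(x̄, 0)` on the hyperplane `x_n = 0`. -/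
def traceFn {m : ℕ} (f : EuclideanSpace ℝ (Fin (m+1)) → ℂ)
    (x : EuclideanSpace ℝ (Fin m)) : ℂ :=
  f ((WithLp.equiv 2 (Fin (m+1) → ℝ)).symm
      (Fin.snoc ((WithLp.equiv 2 (Fin m → ℝ)) x) 0))


section PartA
variable {V : Type*} [NormedAddCommGroup V] [InnerProductSpace ℝ V] [FiniteDimensional ℝ V]
  [MeasurableSpace V] [BorelSpace V]

lemma bump_contDiff (η : ℝ → ℝ) (hη : IsBump η) (R : ℝ) (hR : 0 < R) :
    ContDiff ℝ (⊤ : ℕ∞) (fun ξ : V => ((η (R⁻¹ * ‖ξ‖) : ℝ) : ℂ)) := by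
  have h1 : ContDiff ℝ (⊤ : ℕ∞) (fun ξ : V => η (R⁻¹ * ‖ξ‖)) := by
    rw [contDiff_iff_contDiffAt]
    intro x
    by_cases hx : x = 0
    · have : (fun ξ : V => η (R⁻¹ * ‖ξ‖)) =ᶠ[nhds x] fun _ => (1:ℝ) := by
        subst hx
        filter_upwards [Metric.ball_mem_nhds (0:V) hR] with y hy
        apply hη.2.2.1
        rw [mem_ball_zero_iff] at hy
        rw [abs_of_nonneg (by positivity), inv_mul_le_iff₀ hR]
        linarith
      exact contDiffAt_const.congr_of_eventuallyEq this
    · have h2 : ContDiffAt ℝ (⊤ : ℕ∞) (fun ξ : V => R⁻¹ * ‖ξ‖) x :=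
        contDiffAt_const.mul (contDiffAt_norm ℝ hx)
      exact hη.1.contDiffAt.comp x h2
  exact Complex.ofRealCLM.contDiff.comp h1

lemma bump_compactSupport (η : ℝ → ℝ) (hη : IsBump η) (R : ℝ) (hR : 0 < R) :
    HasCompactSupport (fun ξ : V => ((η (R⁻¹ * ‖ξ‖) : ℝ) : ℂ)) := by
  apply HasCompactSupport.of_support_subset_isCompact (isCompact_closedBall (0:V) (2*R))
  intro x hx
  rw [mem_closedBall_zero_iff]
  by_contra h
  push Not at h
  apply hx
  simp only [Complex.ofReal_eq_zero]
  apply hη.2.2.2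
  rw [abs_of_nonneg (by positivity), le_inv_mul_iff₀ hR]
  linarith

/-- The cutoff as a Schwartz function. -/
def cutS (V : Type*) [NormedAddCommGroup V] [InnerProductSpace ℝ V] [FiniteDimensional ℝ V]
    [MeasurableSpace V] [BorelSpace V] (η : ℝ → ℝ) (hη : IsBump η) (R : ℝ) (hR : 0 < R) :
    SchwartzMap V ℂ :=
  (bump_compactSupport (V := V) η hη R hR).toSchwartzMap (bump_contDiff η hη R hR)

lemma cutS_apply (η : ℝ → ℝ) (hη : IsBump η) (R : ℝ) (hR : 0 < R) (ξ : V) :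
    cutS V η hη R hR ξ = ((η (R⁻¹ * ‖ξ‖) : ℝ) : ℂ) := rfl

/-- The convolution kernel of the cutoff. -/
def kerS (V : Type*) [NormedAddCommGroup V] [InnerProductSpace ℝ V] [FiniteDimensional ℝ V]
    [MeasurableSpace V] [BorelSpace V] (η : ℝ → ℝ) (hη : IsBump η) (R : ℝ) (hR : 0 < R) :
    SchwartzMap V ℂ := 𝓕⁻ (cutS V η hη R hR)

lemma fourier_kerS (η : ℝ → ℝ) (hη : IsBump η) (R : ℝ) (hR : 0 < R) (ξ : V) :
    𝓕 (⇑(kerS V η hη R hR)) ξ = ((η (R⁻¹ * ‖ξ‖) : ℝ) : ℂ) := by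
  rw [← SchwartzMap.fourier_coe, kerS, FourierTransform.fourier_fourierInv_eq, cutS_apply]

lemma kerS_eq (η : ℝ → ℝ) (hη : IsBump η) (R : ℝ) (hR : 0 < R) (x : V) :
    kerS V η hη R hR x = 𝓕⁻ (fun ξ : V => ((η (R⁻¹ * ‖ξ‖) : ℝ) : ℂ)) x := by
  rw [kerS, SchwartzMap.fourierInv_coe]; rfl

lemma kerS_scale (η : ℝ → ℝ) (hη : IsBump η) (R : ℝ) (hR : 0 < R) (x : V) :
    kerS V η hη R hR x =
      ((R ^ Module.finrank ℝ V : ℝ) : ℂ) * kerS V η hη 1 one_pos (R • x) := by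
  rw [kerS_eq, kerS_eq, Real.fourierInv_eq, Real.fourierInv_eq]
  have := Measure.integral_comp_smul (volume : Measure V)
    (fun v : V => Real.fourierChar (inner ℝ v (R • x)) • ((η (1⁻¹ * ‖v‖) : ℝ) : ℂ)) R⁻¹
  have e : (fun v : V => Real.fourierChar (inner ℝ v x) • ((η (R⁻¹ * ‖v‖) : ℝ) : ℂ)) =
     fun v : V => Real.fourierChar (inner ℝ (R⁻¹ • v) (R • x)) • ((η (1⁻¹ * ‖R⁻¹ • v‖) : ℝ) : ℂ) := by
    ext v
    rw [real_inner_smul_left, real_inner_smul_right, norm_smul, Real.norm_of_nonneg (by positivity)]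
    congr 3
    · field_simp
    · simp
  rw [e, this, Complex.real_smul]
  congr 2
  rw [inv_pow, inv_inv, abs_of_pos (by positivity)]

lemma kerS_bound (η : ℝ → ℝ) (hη : IsBump η) :
    ∃ C : ℝ≥0∞, C ≠ ∞ ∧ ∀ (R : ℝ) (hR : 0 < R) (x : V),
      ‖kerS V η hη R hR x‖ₑ ≤ C * ENNReal.ofReal R ^ (Module.finrank ℝ V) := by
  obtain ⟨C, hC⟩ := (kerS V η hη 1 one_pos).toBoundedContinuousFunction.bounded
  refine ⟨ENNReal.ofReal ‖(kerS V η hη 1 one_pos).toBoundedContinuousFunction‖, by simp,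
    fun R hR x => ?_⟩
  rw [kerS_scale, enorm_mul, mul_comm]
  gcongr
  · rw [← ofReal_norm]
    exact ENNReal.ofReal_le_ofReal ((kerS V η hη 1 one_pos).toBoundedContinuousFunction.norm_coe_le_norm _)
  · rw [← ENNReal.ofReal_pow hR.le, ← ofReal_norm, Complex.norm_real, Real.norm_of_nonneg (by positivity)]

lemma kerS_lint (η : ℝ → ℝ) (hη : IsBump η) (p : ℝ) (hp : 0 < p) :
    ∃ C : ℝ≥0∞, C ≠ ∞ ∧ ∀ (R : ℝ) (hR : 0 < R),
      ∫⁻ x : V, ‖kerS V η hη R hR x‖ₑ ^ p =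
        C * ENNReal.ofReal R ^ ((Module.finrank ℝ V : ℝ) * (p - 1)) := by
  refine ⟨∫⁻ x : V, ‖kerS V η hη 1 one_pos x‖ₑ ^ p, ?_, fun R hR => ?_⟩
  · have h := (kerS V η hη 1 one_pos).memLp (ENNReal.ofReal p)
    have h2 := lintegral_rpow_enorm_lt_top_of_eLpNorm_lt_top (by simpa using hp) (by simp) h.2
    rw [ENNReal.toReal_ofReal hp.le] at h2
    exact h2.ne
  · have hR0 : ENNReal.ofReal R ≠ 0 := by simpa using hR
    have key : ∫⁻ x : V, ‖kerS V η hη 1 one_pos (R • x)‖ₑ ^ p =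
        ENNReal.ofReal R ^ (-(Module.finrank ℝ V : ℝ)) * ∫⁻ x : V, ‖kerS V η hη 1 one_pos x‖ₑ ^ p := by
      have hm := Measure.map_addHaar_smul (volume : Measure V) hR.ne'
      have h2 : ∫⁻ x : V, ‖kerS V η hη 1 one_pos x‖ₑ ^ p ∂(Measure.map (R • ·) (volume : Measure V)) =
          ∫⁻ x : V, ‖kerS V η hη 1 one_pos (R • x)‖ₑ ^ p := by
        rw [lintegral_map]
        · have := (kerS V η hη 1 one_pos).continuous
          fun_prop
        · fun_prop
      rw [← h2, hm, lintegral_smul_measure, smul_eq_mul]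
      congr 1
      rw [abs_of_pos (by positivity), ENNReal.ofReal_inv_of_pos (by positivity), ENNReal.ofReal_pow hR.le,
        ENNReal.rpow_neg, ENNReal.rpow_natCast]
    have h3 : ∀ x : V, ‖kerS V η hη R hR x‖ₑ ^ p =
        ENNReal.ofReal R ^ ((Module.finrank ℝ V : ℝ) * p) * ‖kerS V η hη 1 one_pos (R • x)‖ₑ ^ p := by
      intro x
      rw [kerS_scale, enorm_mul, ENNReal.mul_rpow_of_nonneg _ _ hp.le]
      congr 1
      rw [← ofReal_norm, Complex.norm_real, Real.norm_of_nonneg (by positivity), ENNReal.ofReal_pow hR.le,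
        ENNReal.rpow_mul, ENNReal.rpow_natCast]
    simp_rw [h3]
    rw [lintegral_const_mul', key, ← mul_assoc, ← ENNReal.rpow_add _ _ hR0 (by simp), mul_comm]
    · congr 2; ring
    · exact ENNReal.rpow_ne_top_of_ne_zero hR0 (by simp)

/-- Superposition of characters. -/
def expRep {Ω : Type*} [MeasurableSpace Ω] (μ : Measure Ω) (θ : Ω → V) (a : Ω → ℂ) (w : V) : ℂ :=
  ∫ ω, Real.fourierChar (inner ℝ w (θ ω)) • a ω ∂μ

lemma conv_rep {Ω : Type*} [MeasurableSpace Ω] (μ : Measure Ω) [SFinite μ] (θ : Ω → V)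
    (hθ : Measurable θ) (a : Ω → ℂ) (ha : Integrable a μ) (K : V → ℂ) (hK : Integrable K) (w : V) :
    ∫ y, K (w - y) * expRep μ θ a y = expRep μ θ (fun ω => 𝓕 K (θ ω) * a ω) w := by
  have h1 : ∀ y, K (w - y) * expRep μ θ a y =
      ∫ ω, K (w - y) * (Real.fourierChar (inner ℝ y (θ ω)) • a ω) ∂μ := by
    intro y
    rw [expRep, integral_const_mul]
  simp_rw [h1]
  rw [integral_integral_swap]
  · unfold expRep
    congr 1
    ext ω
    rw [← integral_sub_left_eq_self _ volume w]
    simp only [Real.fourier_eq]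
    simp only [sub_sub_cancel, inner_sub_left, Circle.smul_def, smul_eq_mul]
    rw [← integral_mul_const, ← integral_const_mul]
    congr 1
    ext y
    rw [sub_eq_add_neg, AddChar.map_add_eq_mul]
    push_cast
    ring
  · have hKs : Integrable (fun y => K (w - y)) := hK.comp_sub_left w
    have := hKs.mul_prod ha
    have h2 : Continuous fun t : ℝ => ((Real.fourierChar t : Circle) : ℂ) := by fun_prop
    have h3 : Measurable (fun z : V × Ω => ((Real.fourierChar (inner ℝ z.1 (θ z.2)) : Circle) : ℂ)) := by
      apply h2.measurable.comp
      exact measurable_fst.inner (hθ.comp measurable_snd)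
    have h4 := this.bdd_mul (c := 1) h3.aestronglyMeasurable (Filter.Eventually.of_forall fun z => (Circle.norm_coe _).le)
    refine h4.congr (Filter.Eventually.of_forall fun z => ?_)
    simp [Function.uncurry, Circle.smul_def]
    ring

lemma expRep_bound {Ω : Type*} [MeasurableSpace Ω] (μ : Measure Ω) (θ : Ω → V)
    (a : Ω → ℂ) (w : V) : ‖expRep μ θ a w‖ₑ ≤ ∫⁻ ω, ‖a ω‖ₑ ∂μ := by
  refine (enorm_integral_le_lintegral_enorm _).trans (le_of_eq ?_)
  congr 1; ext ω
  rw [← ofReal_norm, Circle.norm_smul, ofReal_norm]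

lemma expRep_cont {Ω : Type*} [MeasurableSpace Ω] (μ : Measure Ω) (θ : Ω → V)
    (hθ : Measurable θ) (a : Ω → ℂ) (ha : Integrable a μ) : Continuous (expRep μ θ a) := by
  have h2 : Continuous fun t : ℝ => ((Real.fourierChar t : Circle) : ℂ) := by fun_prop
  apply continuous_of_dominated (bound := fun ω => ‖a ω‖)
  · intro x
    simp only [Circle.smul_def]
    refine AEStronglyMeasurable.mul (f := fun ω => ((Real.fourierChar (inner ℝ x (θ ω)) : Circle) : ℂ)) ?_ ha.1
    exact (h2.measurable.comp (measurable_const.inner hθ)).aestronglyMeasurable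
  · intro x; simp [Circle.norm_smul]
  · exact ha.norm
  · refine Filter.Eventually.of_forall fun ω => ?_
    simp only [Circle.smul_def]
    fun_prop

end PartA


section PartB

lemma jensen_lint {α : Type*} [MeasurableSpace α] (μ : Measure α) (K h : α → ℝ≥0∞)
    (hK : AEMeasurable K μ) (hh : AEMeasurable h μ) (p : ℝ) (hp : 1 ≤ p) :
    (∫⁻ x, K x * h x ∂μ) ^ p ≤ (∫⁻ x, K x ∂μ) ^ (p - 1) * ∫⁻ x, K x * h x ^ p ∂μ := by
  have hp0 : 0 < p := by linarith
  have hp1 : 1 / p ≤ 1 := by rw [div_le_one hp0]; exact hp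
  have key := ENNReal.lintegral_mul_norm_pow_le (μ := μ) (f := K) (g := fun x => K x * h x ^ p) hK
    (hK.mul (hh.pow_const p)) (p := 1 - 1/p) (q := 1/p) (by linarith) (by positivity) (by ring)
  have e : ∀ x, K x ^ (1 - 1/p) * (K x * h x ^ p) ^ (1/p) = K x * h x := by
    intro x
    rw [ENNReal.mul_rpow_of_nonneg _ _ (by positivity), ← ENNReal.rpow_mul, mul_one_div_cancel hp0.ne',
      ENNReal.rpow_one, ← mul_assoc, ← ENNReal.rpow_add_of_nonneg _ _ (by linarith) (by positivity)]
    simp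
  simp_rw [e] at key
  calc _ ≤ ((∫⁻ x, K x ∂μ) ^ (1 - 1/p) * (∫⁻ x, K x * h x ^ p ∂μ) ^ (1/p)) ^ p := by gcongr
    _ = _ := by
      rw [ENNReal.mul_rpow_of_nonneg _ _ hp0.le, ← ENNReal.rpow_mul, ← ENNReal.rpow_mul,
        one_div_mul_cancel hp0.ne', ENNReal.rpow_one]
      congr 2
      field_simp

variable {V : Type*} [NormedAddCommGroup V] [InnerProductSpace ℝ V] [FiniteDimensional ℝ V]
  [MeasurableSpace V] [BorelSpace V]

lemma conv_enorm_le (K h : V → ℂ) (w : V) :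
    ‖∫ y, K (w - y) * h y‖ₑ ≤ ∫⁻ y, ‖K (w - y)‖ₑ * ‖h y‖ₑ := by
  refine (enorm_integral_le_lintegral_enorm _).trans (le_of_eq ?_)
  simp

lemma nikol_lt (η : ℝ → ℝ) (hη : IsBump η) (p : ℝ) (hp : 0 < p) (hp1 : p ≤ 1) :
    ∃ C : ℝ≥0∞, C ≠ ∞ ∧ ∀ (R : ℝ) (hR : 0 < R) (h : V → ℂ) (B : ℝ≥0∞), B ≠ ∞ →
      (∀ w, ‖h w‖ₑ ≤ B) → (∀ w, h w = ∫ y, kerS V η hη R hR (w - y) * h y) →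
      ∀ w, ‖h w‖ₑ ^ p ≤ C * ENNReal.ofReal R ^ (Module.finrank ℝ V) * ∫⁻ y, ‖h y‖ₑ ^ p := by
  obtain ⟨C, hC, hb⟩ := kerS_bound (V := V) η hη
  refine ⟨C, hC, fun R hR h B hB hhB hrep => ?_⟩
  set D := C * ENNReal.ofReal R ^ (Module.finrank ℝ V) with hD
  have hDtop : D ≠ ∞ := by
    rw [hD]; exact ENNReal.mul_ne_top hC (by simp)
  set I := ∫⁻ y, ‖h y‖ₑ ^ p with hI
  set S := ⨆ w, ‖h w‖ₑ with hS
  have hSB : S ≠ ∞ := ne_top_of_le_ne_top hB (iSup_le hhB)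
  have hle : ∀ w, ‖h w‖ₑ ≤ S := fun w => le_iSup (fun w => ‖h w‖ₑ) w
  have h1 : ∀ w, ‖h w‖ₑ ≤ D * I * S ^ (1 - p) := by
    intro w
    rw [hrep w]
    calc _ ≤ ∫⁻ y, ‖kerS V η hη R hR (w - y)‖ₑ * ‖h y‖ₑ := conv_enorm_le _ _ w
      _ ≤ ∫⁻ y, (D * S ^ (1 - p)) * ‖h y‖ₑ ^ p := by
        apply lintegral_mono
        intro y
        dsimp only
        rw [mul_assoc]
        refine mul_le_mul' (hb R hR _) ?_
        calc ‖h y‖ₑ = ‖h y‖ₑ ^ (1 - p) * ‖h y‖ₑ ^ p := by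
              rw [← ENNReal.rpow_add_of_nonneg _ _ (by linarith) hp.le]; simp
          _ ≤ _ := by gcongr; exact hle y
      _ = _ := by
        rw [lintegral_const_mul']
        · ring
        · exact ENNReal.mul_ne_top hDtop (ENNReal.rpow_ne_top_of_nonneg (by linarith) hSB)
  have h2 : S ≤ D * I * S ^ (1 - p) := iSup_le h1
  intro w
  rcases eq_or_ne S 0 with h0 | h0
  · have := hle w
    rw [h0, nonpos_iff_eq_zero] at this
    rw [this, ENNReal.zero_rpow_of_pos hp]
    exact zero_le
  · have h3 : S ^ p * S ^ (1 - p) ≤ D * I * S ^ (1 - p) := by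
      rw [← ENNReal.rpow_add_of_nonneg _ _ hp.le (by linarith)]; simpa using h2
    have h4 : S ^ (1-p) ≠ 0 := by
      intro h; rw [ENNReal.rpow_eq_zero_iff] at h; rcases h with h | h
      · exact h0 h.1
      · exact hSB h.1
    have h5 : S ^ (1-p) ≠ ∞ := ENNReal.rpow_ne_top_of_nonneg (by linarith) hSB
    have h6 := (ENNReal.mul_le_mul_iff_left h4 h5).1 h3
    exact (by gcongr; exact hle w : ‖h w‖ₑ ^ p ≤ S ^ p).trans h6

lemma nikol_ge (η : ℝ → ℝ) (hη : IsBump η) (p : ℝ) (hp1 : 1 ≤ p) :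
    ∃ C : ℝ≥0∞, C ≠ ∞ ∧ ∀ (R : ℝ) (hR : 0 < R) (h : V → ℂ), Continuous h →
      (∀ w, h w = ∫ y, kerS V η hη R hR (w - y) * h y) →
      ∀ w, ‖h w‖ₑ ^ p ≤ C * ENNReal.ofReal R ^ (Module.finrank ℝ V) * ∫⁻ y, ‖h y‖ₑ ^ p := by
  obtain ⟨C, hC, hb⟩ := kerS_bound (V := V) η hη
  obtain ⟨A, hA, hl⟩ := kerS_lint (V := V) η hη 1 one_pos
  refine ⟨A ^ (p - 1) * C, ENNReal.mul_ne_top (ENNReal.rpow_ne_top_of_nonneg (by linarith) hA) hC,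
    fun R hR h hc hrep w => ?_⟩
  have hkc := (kerS V η hη R hR).continuous
  have hA' : ∫⁻ y, ‖kerS V η hη R hR (w - y)‖ₑ = A := by
    rw [lintegral_sub_left_eq_self (fun y => ‖kerS V η hη R hR y‖ₑ)]
    simpa using hl R hR
  calc ‖h w‖ₑ ^ p ≤ (∫⁻ y, ‖kerS V η hη R hR (w - y)‖ₑ * ‖h y‖ₑ) ^ p := by
        gcongr
        conv_lhs => rw [hrep w]
        exact conv_enorm_le _ _ w
    _ ≤ (∫⁻ y, ‖kerS V η hη R hR (w - y)‖ₑ) ^ (p - 1) *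
        ∫⁻ y, ‖kerS V η hη R hR (w - y)‖ₑ * ‖h y‖ₑ ^ p := by
        apply jensen_lint _ _ _ _ _ p hp1
        · fun_prop
        · fun_prop
    _ ≤ A ^ (p-1) * ∫⁻ y, (C * ENNReal.ofReal R ^ (Module.finrank ℝ V)) * ‖h y‖ₑ ^ p := by
        rw [hA']
        gcongr
        exact hb R hR _
    _ = _ := by
        rw [lintegral_const_mul' _ _ (ENNReal.mul_ne_top hC (by simp))]
        ring

lemma nikol (η : ℝ → ℝ) (hη : IsBump η) (p : ℝ) (hp : 0 < p) :
    ∃ C : ℝ≥0∞, C ≠ ∞ ∧ ∀ (R : ℝ) (hR : 0 < R) (h : V → ℂ) (B : ℝ≥0∞), B ≠ ∞ → Continuous h →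
      (∀ w, ‖h w‖ₑ ≤ B) → (∀ w, h w = ∫ y, kerS V η hη R hR (w - y) * h y) →
      ∀ w, ‖h w‖ₑ ^ p ≤ C * ENNReal.ofReal R ^ (Module.finrank ℝ V) * ∫⁻ y, ‖h y‖ₑ ^ p := by
  rcases le_total p 1 with h1 | h1
  · obtain ⟨C, hC, H⟩ := nikol_lt (V := V) η hη p hp h1
    exact ⟨C, hC, fun R hR h B hB _ hb hr => H R hR h B hB hb hr⟩
  · obtain ⟨C, hC, H⟩ := nikol_ge (V := V) η hη p h1
    exact ⟨C, hC, fun R hR h B hB hc hb hr => H R hR h hc hr⟩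

/-- `L^p → L^1` Nikolskii inequality, `p ≤ 1`. -/
lemma nikol_one (η : ℝ → ℝ) (hη : IsBump η) (p : ℝ) (hp : 0 < p) (hp1 : p ≤ 1) :
    ∃ C : ℝ≥0∞, C ≠ ∞ ∧ ∀ (R : ℝ) (hR : 0 < R) (h : V → ℂ) (B : ℝ≥0∞), B ≠ ∞ →
      (∀ w, ‖h w‖ₑ ≤ B) → (∀ w, h w = ∫ y, kerS V η hη R hR (w - y) * h y) →
      (∫⁻ y, ‖h y‖ₑ) ^ p ≤
        C * ENNReal.ofReal R ^ ((Module.finrank ℝ V : ℝ) * (1 - p)) * ∫⁻ y, ‖h y‖ₑ ^ p := by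
  obtain ⟨C, hC, H⟩ := nikol_lt (V := V) η hη p hp hp1
  refine ⟨C ^ (1 - p), ENNReal.rpow_ne_top_of_nonneg (by linarith) hC,
    fun R hR h B hB hhB hrep => ?_⟩
  have H := H R hR h B hB hhB hrep
  set D := C * ENNReal.ofReal R ^ (Module.finrank ℝ V) with hD
  set I := ∫⁻ y, ‖h y‖ₑ ^ p with hI
  rcases eq_or_ne I ∞ with hIt | hIt
  · rcases eq_or_ne (C ^ (1 - p) * ENNReal.ofReal R ^ ((Module.finrank ℝ V : ℝ) * (1 - p))) 0 with h0 | h0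
    · -- then `C = 0` and `h = 0`
      have hR0 : ENNReal.ofReal R ≠ 0 := by simpa using hR
      rw [mul_eq_zero] at h0
      rcases h0 with h0 | h0
      · rw [ENNReal.rpow_eq_zero_iff] at h0
        rcases h0 with h0 | h0
        · have : ∀ w, ‖h w‖ₑ = 0 := by
            intro w
            have := H w
            rw [hD, h0.1] at this
            simpa [hp] using this
          simp [this, hp]
        · exact absurd h0.1 hC
      · rw [ENNReal.rpow_eq_zero_iff] at h0
        rcases h0 with h0 | h0
        · exact absurd h0.1 hR0
        · simp at h0
    · rw [hIt, ENNReal.mul_top h0]; exact le_top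
  have hDI : D * I ≠ ∞ := ENNReal.mul_ne_top (ENNReal.mul_ne_top hC (by simp)) hIt
  have h1 : ∀ y, ‖h y‖ₑ ≤ (D * I) ^ ((1 - p) / p) * ‖h y‖ₑ ^ p := by
    intro y
    calc ‖h y‖ₑ = (‖h y‖ₑ ^ p) ^ ((1 - p) / p) * ‖h y‖ₑ ^ p := by
          rw [← ENNReal.rpow_mul, mul_div_cancel₀ _ hp.ne',
            ← ENNReal.rpow_add_of_nonneg _ _ (by linarith) hp.le]; simp
      _ ≤ _ := by
        gcongr
        exact H y
  calc (∫⁻ y, ‖h y‖ₑ) ^ p ≤ (∫⁻ y, (D * I) ^ ((1 - p) / p) * ‖h y‖ₑ ^ p) ^ p := by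
        gcongr with y
        exact h1 y
    _ = ((D * I) ^ ((1 - p) / p) * I) ^ p := by
        rw [lintegral_const_mul']
        exact ENNReal.rpow_ne_top_of_nonneg (div_nonneg (by linarith) hp.le) hDI
    _ = D ^ (1 - p) * (I ^ (1 - p) * I ^ p) := by
        rw [ENNReal.mul_rpow_of_nonneg _ _ hp.le, ← ENNReal.rpow_mul, div_mul_cancel₀ _ hp.ne',
          ENNReal.mul_rpow_of_nonneg _ _ (by linarith), mul_assoc]
    _ = D ^ (1 - p) * I := by
        rw [← ENNReal.rpow_add_of_nonneg _ _ (by linarith) hp.le]; simp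
    _ = _ := by
        rw [hD, ENNReal.mul_rpow_of_nonneg _ _ (by linarith), ENNReal.rpow_mul, ENNReal.rpow_natCast]

/-- reproducing formula -/
lemma expRep_repro {Ω : Type*} [MeasurableSpace Ω] (μ : Measure Ω) [SFinite μ] (θ : Ω → V)
    (hθ : Measurable θ) (a : Ω → ℂ) (ha : Integrable a μ) (η : ℝ → ℝ) (hη : IsBump η)
    (R : ℝ) (hR : 0 < R) (hsupp : ∀ ω, a ω ≠ 0 → ‖θ ω‖ ≤ R) (w : V) :
    expRep μ θ a w = ∫ y, kerS V η hη R hR (w - y) * expRep μ θ a y := by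
  rw [conv_rep μ θ hθ a ha _ (kerS V η hη R hR).integrable]
  congr 1
  ext ω
  by_cases h : a ω = 0
  · simp [h]
  · rw [fourier_kerS, hη.2.2.1]
    · simp
    · rw [abs_of_nonneg (by positivity), inv_mul_le_iff₀ hR]
      simpa using hsupp ω h

end PartB


section PartC

/-- `(x̄, t)` as a point of Euclidean space. -/
def emb {m : ℕ} (x : EuclideanSpace ℝ (Fin m)) (t : ℝ) : EuclideanSpace ℝ (Fin (m+1)) :=
  (WithLp.equiv 2 (Fin (m+1) → ℝ)).symm (Fin.snoc ((WithLp.equiv 2 (Fin m → ℝ)) x) t)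

/-- Projection to the first coordinates. -/
def prj {m : ℕ} (ξ : EuclideanSpace ℝ (Fin (m+1))) : EuclideanSpace ℝ (Fin m) :=
  WithLp.toLp 2 (fun i => ξ i.castSucc)

lemma emb_castSucc {m : ℕ} (x : EuclideanSpace ℝ (Fin m)) (t : ℝ) (i : Fin m) :
    emb x t i.castSucc = x i := by
  simp [emb]

lemma emb_last {m : ℕ} (x : EuclideanSpace ℝ (Fin m)) (t : ℝ) :
    emb x t (Fin.last m) = t := by
  simp [emb]

lemma inner_emb {m : ℕ} (x : EuclideanSpace ℝ (Fin m)) (t : ℝ) (ξ : EuclideanSpace ℝ (Fin (m+1))) :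
    inner ℝ ξ (emb x t) = inner ℝ x (prj ξ) + inner ℝ t (ξ (Fin.last m)) := by
  simp only [PiLp.inner_apply, Fin.sum_univ_castSucc, emb_castSucc, emb_last, prj]
  simp [mul_comm]

lemma norm_prj_le {m : ℕ} (ξ : EuclideanSpace ℝ (Fin (m+1))) : ‖prj ξ‖ ≤ ‖ξ‖ := by
  apply le_of_sq_le_sq _ (norm_nonneg _)
  rw [EuclideanSpace.norm_sq_eq, EuclideanSpace.norm_sq_eq, Fin.sum_univ_castSucc]
  simp only [prj]
  have : 0 ≤ ‖ξ (Fin.last m)‖ ^ 2 := by positivity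
  linarith

lemma norm_last_le {m : ℕ} (ξ : EuclideanSpace ℝ (Fin (m+1))) : ‖ξ (Fin.last m)‖ ≤ ‖ξ‖ :=
  PiLp.norm_apply_le ξ _

lemma prj_cont {m : ℕ} : Continuous (prj : EuclideanSpace ℝ (Fin (m+1)) → EuclideanSpace ℝ (Fin m)) := by
  unfold prj; fun_prop

lemma emb_cont {m : ℕ} : Continuous (fun z : EuclideanSpace ℝ (Fin m) × ℝ => emb z.1 z.2) := by
  unfold emb
  simp only [WithLp.equiv_symm_apply, WithLp.equiv_apply]
  apply (PiLp.continuous_toLp 2 _).comp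
  apply continuous_pi
  intro i
  refine Fin.lastCases ?_ (fun i => ?_) i
  · simp only [Fin.snoc_last]; fun_prop
  · simp only [Fin.snoc_castSucc]; fun_prop

/-- The embedding of the hyperplane as a linear isometry. -/
def embL (m : ℕ) : EuclideanSpace ℝ (Fin m) →ₗᵢ[ℝ] EuclideanSpace ℝ (Fin (m+1)) where
  toFun x := emb x 0
  map_add' x y := by
    ext i
    refine Fin.lastCases ?_ (fun i => ?_) i
    · simp [emb_last]
    · simp [emb_castSucc]
  map_smul' c x := by
    ext i
    refine Fin.lastCases ?_ (fun i => ?_) i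
    · simp [emb_last]
    · simp [emb_castSucc]
  norm_map' x := by
    change ‖emb x 0‖ = ‖x‖
    rw [EuclideanSpace.norm_eq, EuclideanSpace.norm_eq, Fin.sum_univ_castSucc]
    simp [emb_castSucc, emb_last]

/-- The trace as a Schwartz function. -/
def trS {m : ℕ} (f : SchwartzMap (EuclideanSpace ℝ (Fin (m+1))) ℂ) :
    SchwartzMap (EuclideanSpace ℝ (Fin m)) ℂ :=
  SchwartzMap.compCLMOfAntilipschitz ℂ (g := embL m)
    (embL m).toContinuousLinearMap.hasTemperateGrowth (embL m).antilipschitz f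

lemma trS_coe {m : ℕ} (f : SchwartzMap (EuclideanSpace ℝ (Fin (m+1))) ℂ) :
    ⇑(trS f) = traceFn ⇑f := rfl

lemma lint_split {m : ℕ} (u : EuclideanSpace ℝ (Fin (m+1)) → ℝ≥0∞) (hu : Measurable u) :
    ∫⁻ z, u z = ∫⁻ x : EuclideanSpace ℝ (Fin m), ∫⁻ t : ℝ, u (emb x t) := by
  have h1 := PiLp.volume_preserving_toLp (Fin (m+1))
  have h2 := (volume_preserving_piFinSuccAbove (fun _ : Fin (m+1) => ℝ) (Fin.last m)).symm
  have h3 := PiLp.volume_preserving_ofLp (Fin m)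
  rw [← h1.lintegral_comp hu,
    ← h2.lintegral_comp (f := fun a => u (WithLp.toLp 2 a)) (hu.comp h1.measurable)]
  rw [Measure.volume_eq_prod, lintegral_prod_symm]
  · have hm : Measurable fun x : Fin m → ℝ => ∫⁻ t : ℝ, u (WithLp.toLp 2 (Fin.snoc x t : Fin (m+1) → ℝ)) := by
      apply Measurable.lintegral_prod_right' (f := fun z : (Fin m → ℝ) × ℝ =>
        u (WithLp.toLp 2 (Fin.snoc z.1 z.2 : Fin (m+1) → ℝ)))
      apply hu.comp
      have := (emb_cont (m := m)).measurable.comp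
        ((PiLp.volume_preserving_toLp (Fin m)).measurable.prodMap (measurable_id (α := ℝ)))
      exact this
    have e := h3.lintegral_comp hm
    have : (fun x : EuclideanSpace ℝ (Fin m) => ∫⁻ t : ℝ, u (emb x t)) = fun x =>
      ∫⁻ t : ℝ, u (WithLp.toLp 2 (Fin.snoc (WithLp.ofLp x) t : Fin (m+1) → ℝ)) := rfl
    rw [this, e]
    apply lintegral_congr_ae
    refine Filter.Eventually.of_forall fun x => ?_
    dsimp only
    congr 1
    ext t
    congr 2
    ext i
    refine Fin.lastCases ?_ (fun i => ?_) i
    · simp [MeasurableEquiv.piFinSuccAbove]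
    · simp [MeasurableEquiv.piFinSuccAbove]
  · exact ((hu.comp h1.measurable).comp h2.measurable).aemeasurable

end PartC


section PartD

lemma two_rpow_neg (j : ℕ) : (2:ℝ) ^ (-(j:ℝ)) = ((2:ℝ) ^ j)⁻¹ := by
  rw [Real.rpow_neg (by norm_num), Real.rpow_natCast]

lemma two_rpow_neg_succ (j : ℕ) : (2:ℝ) ^ (-((j+1 : ℕ):ℝ) + 1) = ((2:ℝ) ^ j)⁻¹ := by
  rw [← two_rpow_neg]; congr 1; push_cast; ring

/-- Littlewood–Paley pieces as Schwartz functions. -/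
def lpS (d : ℕ) (η : ℝ → ℝ) (hη : IsBump η) : ℕ → SchwartzMap (EuclideanSpace ℝ (Fin d)) ℂ
  | 0 => cutS _ η hη 1 one_pos
  | (j+1) => cutS _ η hη (2 ^ (j+1)) (by positivity) - cutS _ η hη (2 ^ j) (by positivity)

lemma lpS_apply {d : ℕ} (η : ℝ → ℝ) (hη : IsBump η) (j : ℕ) (ξ : EuclideanSpace ℝ (Fin d)) :
    lpS d η hη j ξ = (littlewood η j ξ : ℂ) := by
  cases j with
  | zero => simp [lpS, littlewood, cutS_apply]
  | succ j =>
    rw [lpS, littlewood, if_neg (Nat.succ_ne_zero j), two_rpow_neg, two_rpow_neg_succ,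
      _root_.sub_apply, cutS_apply, cutS_apply]
    push_cast; rfl

/-- Littlewood–Paley kernels. -/
def kS (d : ℕ) (η : ℝ → ℝ) (hη : IsBump η) (j : ℕ) : SchwartzMap (EuclideanSpace ℝ (Fin d)) ℂ :=
  𝓕⁻ (lpS d η hη j)

lemma fourier_kS {d : ℕ} (η : ℝ → ℝ) (hη : IsBump η) (j : ℕ) (ξ : EuclideanSpace ℝ (Fin d)) :
    𝓕 (⇑(kS d η hη j)) ξ = (littlewood η j ξ : ℂ) := by
  rw [← SchwartzMap.fourier_coe, kS, FourierTransform.fourier_fourierInv_eq, lpS_apply]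

lemma kS_zero (d : ℕ) (η : ℝ → ℝ) (hη : IsBump η) : kS d η hη 0 = kerS _ η hη 1 one_pos := rfl

lemma kS_succ (d : ℕ) (η : ℝ → ℝ) (hη : IsBump η) (j : ℕ) : kS d η hη (j+1) =
    kerS _ η hη (2 ^ (j+1)) (by positivity) - kerS _ η hη (2 ^ j) (by positivity) := by
  rw [kS, lpS, sub_eq_add_neg, ← neg_one_smul ℂ, FourierTransform.fourierInv_add,
    FourierTransform.fourierInv_smul, neg_one_smul, ← sub_eq_add_neg]; rfl

lemma kS_eq_expRep {d : ℕ} (η : ℝ → ℝ) (hη : IsBump η) (j : ℕ) (x : EuclideanSpace ℝ (Fin d)) :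
    kS d η hη j x = ∫ ζ : EuclideanSpace ℝ (Fin d), Real.fourierChar (inner ℝ ζ x) • lpS d η hη j ζ := by
  rw [kS, SchwartzMap.fourierInv_coe, Real.fourierInv_eq]

lemma kS_lint (d : ℕ) (η : ℝ → ℝ) (hη : IsBump η) (p : ℝ) (hp : 0 < p) (hp1 : p ≤ 1) :
    ∃ C : ℝ≥0∞, C ≠ ∞ ∧ ∀ k : ℕ,
      ∫⁻ x, ‖kS d η hη k x‖ₑ ^ p ≤
        C * ENNReal.ofReal (2 ^ k) ^ ((d : ℝ) * (p - 1)) := by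
  obtain ⟨C, hC, H⟩ := kerS_lint (V := EuclideanSpace ℝ (Fin d)) η hη p hp
  simp only [finrank_euclideanSpace_fin] at H
  have h2 : ENNReal.ofReal 2 ^ ((d:ℝ) * (1 - p)) ≠ ∞ := 
    ENNReal.rpow_ne_top_of_nonneg (mul_nonneg (by positivity) (by linarith)) (by simp)
  refine ⟨C + C * ENNReal.ofReal 2 ^ ((d:ℝ) * (1 - p)), by simp [hC, ENNReal.mul_ne_top, h2], fun k => ?_⟩
  cases k with
  | zero =>
    rw [kS_zero, H]
    simp
  | succ j =>
    rw [kS_succ]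
    calc _ ≤ ∫⁻ x, (‖kerS (EuclideanSpace ℝ (Fin d)) η hη (2 ^ (j+1)) (by positivity) x‖ₑ ^ p +
          ‖kerS (EuclideanSpace ℝ (Fin d)) η hη (2 ^ j) (by positivity) x‖ₑ ^ p) := by
          gcongr with x
          rw [_root_.sub_apply]
          exact (by gcongr; exact enorm_sub_le : _ ≤ _).trans (ENNReal.rpow_add_le_add_rpow _ _ hp.le hp1)
      _ = _ := by
          rw [lintegral_add_left, H, H, add_mul]
          · congr 1
            rw [mul_assoc]
            congr 1
            rw [pow_succ, ENNReal.ofReal_mul (by positivity), ENNReal.mul_rpow_of_ne_top (by simp) (by simp),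
              mul_left_comm, ← ENNReal.rpow_add _ _ (by simp) (by simp)]
            have : (d:ℝ) * (1 - p) + d * (p - 1) = 0 := by ring
            rw [this]; simp
          · have := (kerS (EuclideanSpace ℝ (Fin d)) η hη (2 ^ (j+1)) (by positivity)).continuous
            fun_prop

lemma lw_supp {d : ℕ} (η : ℝ → ℝ) (hη : IsBump η) (j : ℕ) (ξ : EuclideanSpace ℝ (Fin d))
    (h : littlewood η j ξ ≠ 0) : ‖ξ‖ < 2 ^ (j+1) := by
  by_contra hc
  push Not at hc
  apply h
  cases j with
  | zero =>
    simp only [littlewood, if_pos]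
    apply hη.2.2.2
    rw [abs_of_nonneg (norm_nonneg _)]; simpa using hc
  | succ j =>
    rw [littlewood, if_neg (Nat.succ_ne_zero j), two_rpow_neg, two_rpow_neg_succ, hη.2.2.2, hη.2.2.2, sub_zero]
    · rw [abs_of_nonneg (by positivity), le_inv_mul_iff₀ (by positivity)]
      refine le_trans ?_ hc
      rw [pow_succ, pow_succ]
      have : (0:ℝ) < 2 ^ j := by positivity
      linarith
    · rw [abs_of_nonneg (by positivity), le_inv_mul_iff₀ (by positivity)]
      refine le_trans (le_of_eq ?_) hc
      ring

lemma lw_supp' {d : ℕ} (η : ℝ → ℝ) (hη : IsBump η) (j : ℕ) (ξ : EuclideanSpace ℝ (Fin d))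
    (h : littlewood η (j+1) ξ ≠ 0) : 2 ^ j < ‖ξ‖ := by
  by_contra hc
  push Not at hc
  apply h
  rw [littlewood, if_neg (Nat.succ_ne_zero j), two_rpow_neg, two_rpow_neg_succ, hη.2.2.1, hη.2.2.1, sub_self]
  · rw [abs_of_nonneg (by positivity), inv_mul_le_iff₀ (by positivity)]
    linarith
  · rw [abs_of_nonneg (by positivity), inv_mul_le_iff₀ (by positivity)]
    refine hc.trans ?_
    rw [pow_succ]
    have : (0:ℝ) < 2 ^ j := by positivity
    linarith

lemma lw_sum {d : ℕ} (η : ℝ → ℝ) (J : ℕ) (ξ : EuclideanSpace ℝ (Fin d)) :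
    ∑ j ∈ Finset.range (J+1), littlewood η j ξ = η (((2:ℝ)^J)⁻¹ * ‖ξ‖) := by
  induction J with
  | zero => simp [littlewood]
  | succ J ih =>
    rw [Finset.sum_range_succ, ih, littlewood, if_neg (Nat.succ_ne_zero J), two_rpow_neg, two_rpow_neg_succ]
    ring

lemma lw_bound {d : ℕ} (η : ℝ → ℝ) (hη : IsBump η) (j : ℕ) (ξ : EuclideanSpace ℝ (Fin d)) :
    ‖(littlewood η j ξ : ℂ)‖ ≤ 1 := by
  rw [Complex.norm_real, Real.norm_eq_abs, abs_le]
  cases j with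
  | zero =>
    simp only [littlewood, if_pos]
    have := hη.2.1 ‖ξ‖
    exact ⟨by linarith [this.1], this.2⟩
  | succ j =>
    rw [littlewood, if_neg (Nat.succ_ne_zero j), two_rpow_neg, two_rpow_neg_succ]
    have h1 := hη.2.1 (((2:ℝ) ^ (j+1))⁻¹ * ‖ξ‖)
    have h2 := hη.2.1 (((2:ℝ) ^ j)⁻¹ * ‖ξ‖)
    exact ⟨by linarith [h1.1, h2.2], by linarith [h1.2, h2.1]⟩

lemma lw_cont {d : ℕ} (η : ℝ → ℝ) (hη : IsBump η) (j : ℕ) :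
    Continuous (fun ξ : EuclideanSpace ℝ (Fin d) => (littlewood η j ξ : ℂ)) := by
  have : (fun ξ : EuclideanSpace ℝ (Fin d) => (littlewood η j ξ : ℂ)) = lpS d η hη j := by
    ext ξ; rw [lpS_apply]
  rw [this]; exact (lpS d η hη j).continuous

variable {m : ℕ}

/-- Fourier side of `Δ_j f`. -/
def GG (η : ℝ → ℝ) (f : SchwartzMap (EuclideanSpace ℝ (Fin (m+1))) ℂ) (j : ℕ)
    (ξ : EuclideanSpace ℝ (Fin (m+1))) : ℂ := (littlewood η j ξ : ℂ) * 𝓕 (⇑f) ξ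

lemma fourier_int (f : SchwartzMap (EuclideanSpace ℝ (Fin (m+1))) ℂ) : Integrable (𝓕 (⇑f)) := by
  rw [← SchwartzMap.fourier_coe]; exact (𝓕 f).integrable

lemma GG_int (η : ℝ → ℝ) (hη : IsBump η) (f : SchwartzMap (EuclideanSpace ℝ (Fin (m+1))) ℂ) (j : ℕ) :
    Integrable (GG η f j) :=
  (fourier_int f).bdd_mul (c := 1) (lw_cont η hη j).aestronglyMeasurable
    (Filter.Eventually.of_forall (lw_bound η hη j))

lemma GG_supp (η : ℝ → ℝ) (hη : IsBump η) (f : SchwartzMap (EuclideanSpace ℝ (Fin (m+1))) ℂ) (j : ℕ)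
    (ξ : EuclideanSpace ℝ (Fin (m+1))) (h : GG η f j ξ ≠ 0) : ‖ξ‖ < 2 ^ (j+1) := by
  apply lw_supp η hη j ξ
  intro h0
  apply h
  simp [GG, h0]

lemma box_emb (η : ℝ → ℝ) (f : SchwartzMap (EuclideanSpace ℝ (Fin (m+1))) ℂ) (j : ℕ)
    (x : EuclideanSpace ℝ (Fin m)) :
    dyadicBox η j f (emb x 0) = expRep volume prj (GG η f j) x := by
  rw [dyadicBox, Real.fourierInv_eq, expRep]
  simp only [inner_emb]
  simp [GG]

lemma box_emb_line (η : ℝ → ℝ) (f : SchwartzMap (EuclideanSpace ℝ (Fin (m+1))) ℂ) (j : ℕ)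
    (x : EuclideanSpace ℝ (Fin m)) (t : ℝ) :
    dyadicBox η j f (emb x t) = expRep volume (fun ξ => ξ (Fin.last m))
      (fun ξ => Real.fourierChar (inner ℝ x (prj ξ)) • GG η f j ξ) t := by
  rw [dyadicBox, Real.fourierInv_eq, expRep]
  simp only [inner_emb]
  congr 1
  ext ξ
  rw [AddChar.map_add_eq_mul, mul_comm, mul_smul]
  rfl

lemma char_int {Ω : Type*} [MeasurableSpace Ω] (μ : Measure Ω) (u : Ω → ℝ) (hu : Measurable u)
    (a : Ω → ℂ) (ha : Integrable a μ) : Integrable (fun ω => Real.fourierChar (u ω) • a ω) μ := by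
  have h2 : Continuous fun t : ℝ => ((Real.fourierChar t : Circle) : ℂ) := by fun_prop
  simp only [Circle.smul_def]
  exact ha.bdd_mul (c := 1) (h2.measurable.comp hu).aestronglyMeasurable
    (Filter.Eventually.of_forall fun z => (Circle.norm_coe _).le)

lemma trace_lint (η : ℝ → ℝ) (hη : IsBump η) (p : ℝ) (hp : 0 < p) :
    ∃ C : ℝ≥0∞, C ≠ ∞ ∧ ∀ (f : SchwartzMap (EuclideanSpace ℝ (Fin (m+1))) ℂ) (j : ℕ),
      ∫⁻ x : EuclideanSpace ℝ (Fin m), ‖dyadicBox η j f (emb x 0)‖ₑ ^ p ≤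
        C * ENNReal.ofReal (2 ^ j) * ∫⁻ z, ‖dyadicBox η j f z‖ₑ ^ p := by
  obtain ⟨C, hC, H⟩ := nikol (V := ℝ) η hη p hp
  refine ⟨C * 2, ENNReal.mul_ne_top hC (by simp), fun f j => ?_⟩
  have hcont : Continuous (dyadicBox η j f) := by
    have : dyadicBox η j f = expRep volume (fun ξ => ξ) (GG η f j) := by
      ext x
      rw [dyadicBox, Real.fourierInv_eq, expRep]
      simp only [GG, real_inner_comm]
    rw [this]
    exact expRep_cont _ _ measurable_id _ (GG_int η hη f j)
  rw [lint_split _ (by fun_prop), ← lintegral_const_mul']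
  · apply lintegral_mono
    intro x
    dsimp only
    have hlast : Measurable (fun ξ : EuclideanSpace ℝ (Fin (m+1)) => ξ (Fin.last m)) := by fun_prop
    have hi := char_int volume (fun ξ => inner ℝ x (prj ξ))
      (measurable_const.inner (prj_cont (m := m)).measurable) _ (GG_int η hη f j)
    have := H (2 ^ (j+1)) (by positivity) (fun t => dyadicBox η j f (emb x t))
      (∫⁻ ξ, ‖GG η f j ξ‖ₑ) (GG_int η hη f j).2.ne
      (hcont.comp (emb_cont.comp (by fun_prop : Continuous fun t : ℝ => (x, t))))
      (by
        intro t
        rw [box_emb_line]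
        refine (expRep_bound _ _ _ _).trans (le_of_eq ?_)
        congr 1; ext ω
        rw [← ofReal_norm, Circle.norm_smul, ofReal_norm])
      (by
        intro t
        simp only [box_emb_line]
        apply expRep_repro volume _ hlast _ hi
        intro ξ hξ
        refine (norm_last_le ξ).trans (GG_supp η hη f j ξ ?_).le
        intro h0
        apply hξ
        simp [h0]) 0
    refine this.trans (le_of_eq ?_)
    rw [Module.finrank_self, pow_one, pow_succ, ENNReal.ofReal_mul (by positivity)]
    simp only [ENNReal.ofReal_ofNat]
    ring
  · exact ENNReal.mul_ne_top (ENNReal.mul_ne_top hC (by simp)) (by simp)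

/-- The pieces `Δ_k Tr Δ_j f`. -/
def DD (η : ℝ → ℝ) (f : SchwartzMap (EuclideanSpace ℝ (Fin (m+1))) ℂ) (k j : ℕ) :
    EuclideanSpace ℝ (Fin m) → ℂ :=
  expRep volume prj (fun ξ => (littlewood η k (prj ξ) : ℂ) * GG η f j ξ)

lemma DD_conv (η : ℝ → ℝ) (hη : IsBump η) (f : SchwartzMap (EuclideanSpace ℝ (Fin (m+1))) ℂ) (k j : ℕ)
    (x : EuclideanSpace ℝ (Fin m)) :
    DD η f k j x = ∫ y, kS m η hη k (x - y) * dyadicBox η j f (emb y 0) := by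
  simp only [box_emb]
  rw [conv_rep volume prj prj_cont.measurable _ (GG_int η hη f j) _ (kS m η hη k).integrable]
  simp only [fourier_kS]
  rfl

lemma DD_cont (η : ℝ → ℝ) (hη : IsBump η) (f : SchwartzMap (EuclideanSpace ℝ (Fin (m+1))) ℂ) (k j : ℕ) :
    Continuous (DD η f k j) := by
  apply expRep_cont _ _ prj_cont.measurable
  exact (GG_int η hη f j).bdd_mul (c := 1) ((lw_cont η hη k).comp prj_cont).aestronglyMeasurable
    (Filter.Eventually.of_forall fun ξ => lw_bound η hη k (prj ξ))

lemma DD_zero (η : ℝ → ℝ) (hη : IsBump η) (f : SchwartzMap (EuclideanSpace ℝ (Fin (m+1))) ℂ) (k j : ℕ)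
    (hkj : j + 1 < k) : DD η f k j = 0 := by
  obtain ⟨l, rfl⟩ : ∃ l, k = l + 1 := ⟨k - 1, by omega⟩
  have : (fun ξ => (littlewood η (l+1) (prj ξ) : ℂ) * GG η f j ξ) = 0 := by
    ext ξ
    by_contra h
    simp only [Pi.zero_apply] at h
    have h1 := left_ne_zero_of_mul h
    have h2 := right_ne_zero_of_mul h
    have h3 := lw_supp' η hη l (prj ξ) (by exact_mod_cast h1)
    have h4 := GG_supp η hη f j ξ h2
    have h5 := norm_prj_le ξ
    have h6 : (2:ℝ) ^ (j+1) ≤ 2 ^ l := pow_le_pow_right₀ (by norm_num) (by omega)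
    linarith
  ext x
  rw [DD, this, expRep]
  simp

lemma box_trace (η : ℝ → ℝ) (hη : IsBump η) (f : SchwartzMap (EuclideanSpace ℝ (Fin (m+1))) ℂ) (k : ℕ)
    (x : EuclideanSpace ℝ (Fin m)) :
    dyadicBox η k (traceFn ⇑f) x =
      expRep volume prj (fun ξ => (littlewood η k (prj ξ) : ℂ) * 𝓕 (⇑f) ξ) x := by
  have h1 : dyadicBox η k (traceFn ⇑f) x =
      expRep volume (fun ξ => ξ) (fun ξ => 𝓕 (⇑(kS m η hη k)) ξ * 𝓕 (⇑(trS f)) ξ) x := by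
    rw [dyadicBox, Real.fourierInv_eq, expRep]
    simp only [fourier_kS, trS_coe, real_inner_comm]
  have h2 : ∀ y, expRep volume (fun ξ => ξ) (𝓕 (⇑(trS f))) y = expRep volume prj (𝓕 (⇑f)) y := by
    intro y
    have e1 : expRep volume (fun ξ => ξ) (𝓕 (⇑(trS f))) y = trS f y := by
      conv_rhs => rw [← FourierTransform.fourierInv_fourier_eq (F := SchwartzMap (EuclideanSpace ℝ (Fin m)) ℂ) (trS f)]
      rw [SchwartzMap.fourierInv_coe, SchwartzMap.fourier_coe, Real.fourierInv_eq, expRep]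
      simp only [real_inner_comm]
    have e2 : expRep volume prj (𝓕 (⇑f)) y = f (emb y 0) := by
      conv_rhs => rw [← FourierTransform.fourierInv_fourier_eq (F := SchwartzMap (EuclideanSpace ℝ (Fin (m+1))) ℂ) f]
      rw [SchwartzMap.fourierInv_coe, SchwartzMap.fourier_coe, Real.fourierInv_eq, expRep]
      simp [inner_emb]
    rw [e1, e2]; rfl
  have hti : Integrable (𝓕 (⇑(trS f))) := by
    rw [← SchwartzMap.fourier_coe]; exact (𝓕 (trS f)).integrable
  rw [h1, ← conv_rep volume (fun ξ => ξ) measurable_id _ hti _ (kS m η hη k).integrable]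
  simp only [h2]
  rw [conv_rep volume prj prj_cont.measurable _ (fourier_int f) _ (kS m η hη k).integrable]
  simp only [fourier_kS]

lemma DD_tendsto (η : ℝ → ℝ) (hη : IsBump η) (f : SchwartzMap (EuclideanSpace ℝ (Fin (m+1))) ℂ) (k : ℕ)
    (x : EuclideanSpace ℝ (Fin m)) :
    Filter.Tendsto (fun J => ∑ j ∈ Finset.range (J+1), DD η f k j x) Filter.atTop
      (nhds (dyadicBox η k (traceFn ⇑f) x)) := by
  have hIntg : ∀ j, Integrable (fun ξ => Real.fourierChar (inner ℝ x (prj ξ)) •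
      ((littlewood η k (prj ξ) : ℂ) * GG η f j ξ)) := by
    intro j
    apply char_int volume _ (measurable_const.inner (prj_cont (m := m)).measurable)
    exact (GG_int η hη f j).bdd_mul (c := 1) ((lw_cont η hη k).comp prj_cont).aestronglyMeasurable
      (Filter.Eventually.of_forall fun ξ => lw_bound η hη k (prj ξ))
  have e : ∀ J, ∑ j ∈ Finset.range (J+1), DD η f k j x =
      ∫ ξ, ∑ j ∈ Finset.range (J+1), Real.fourierChar (inner ℝ x (prj ξ)) •
      ((littlewood η k (prj ξ) : ℂ) * GG η f j ξ) := by
    intro J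
    rw [integral_finsetSum _ (fun j _ => hIntg j)]
    rfl
  have e2 : ∀ J ξ, ∑ j ∈ Finset.range (J+1), Real.fourierChar (inner ℝ x (prj ξ)) •
      ((littlewood η k (prj ξ) : ℂ) * GG η f j ξ) = Real.fourierChar (inner ℝ x (prj ξ)) •
      ((littlewood η k (prj ξ) : ℂ) * (((η (((2:ℝ)^J)⁻¹ * ‖ξ‖) : ℝ) : ℂ) * 𝓕 (⇑f) ξ)) := by
    intro J ξ
    rw [← Finset.smul_sum, ← Finset.mul_sum, ← lw_sum η J ξ]
    push_cast
    rw [Finset.sum_mul]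
    rfl
  rw [box_trace η hη]
  simp only [e]
  unfold expRep
  apply tendsto_integral_of_dominated_convergence (fun ξ => ‖𝓕 (⇑f) ξ‖)
  · intro J
    exact (integrable_finsetSum _ (fun j _ => hIntg j)).1
  · exact (fourier_int f).norm
  · intro J
    refine Filter.Eventually.of_forall fun ξ => ?_
    rw [e2, Circle.norm_smul, norm_mul, norm_mul]
    have h1 := lw_bound η hη k (prj ξ)
    have h2 : ‖((η (((2:ℝ)^J)⁻¹ * ‖ξ‖) : ℝ) : ℂ)‖ ≤ 1 := by
      have := hη.2.1 (((2:ℝ)^J)⁻¹ * ‖ξ‖)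
      rw [Complex.norm_real, Real.norm_of_nonneg this.1]; exact this.2
    calc _ ≤ 1 * (1 * ‖𝓕 (⇑f) ξ‖) := by gcongr
      _ = _ := by ring
  · refine Filter.Eventually.of_forall fun ξ => ?_
    apply tendsto_const_nhds.congr'
    obtain ⟨N, hN⟩ := pow_unbounded_of_one_lt ‖ξ‖ (one_lt_two : (1:ℝ) < 2)
    filter_upwards [Filter.eventually_ge_atTop N] with J hJ
    rw [e2, hη.2.2.1]
    · simp
    · rw [abs_of_nonneg (by positivity), inv_mul_le_iff₀ (by positivity), mul_one]
      exact hN.le.trans (pow_le_pow_right₀ (by norm_num) hJ)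

end PartD


section PartE
variable {m : ℕ}

lemma box_cont (η : ℝ → ℝ) (hη : IsBump η) (f : SchwartzMap (EuclideanSpace ℝ (Fin (m+1))) ℂ) (j : ℕ) :
    Continuous (dyadicBox η j f) := by
  have : dyadicBox η j f = expRep volume (fun ξ => ξ) (GG η f j) := by
    ext x
    rw [dyadicBox, Real.fourierInv_eq, expRep]
    simp only [GG, real_inner_comm]
  rw [this]
  exact expRep_cont _ _ measurable_id _ (GG_int η hη f j)

lemma tr_box_cont (η : ℝ → ℝ) (hη : IsBump η) (f : SchwartzMap (EuclideanSpace ℝ (Fin (m+1))) ℂ) (j : ℕ) :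
    Continuous (fun y : EuclideanSpace ℝ (Fin m) => dyadicBox η j f (emb y 0)) :=
  (box_cont η hη f j).comp (emb_cont.comp (by fun_prop : Continuous fun y => (y, (0:ℝ))))

lemma lint_conv (K g : EuclideanSpace ℝ (Fin m) → ℝ≥0∞) (hK : Measurable K) (hg : Measurable g) :
    ∫⁻ x, ∫⁻ y, K (x - y) * g y = (∫⁻ x, K x) * ∫⁻ y, g y := by
  rw [lintegral_lintegral_swap]
  · have : ∀ y, ∫⁻ x, K (x - y) * g y = (∫⁻ x, K x) * g y := by
      intro y
      rw [lintegral_mul_const _ (by fun_prop), lintegral_sub_right_eq_self K y]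
    simp_rw [this]
    rw [lintegral_const_mul _ hg]
  · exact ((hK.comp (measurable_fst.sub measurable_snd)).mul (hg.comp measurable_snd)).aemeasurable

lemma DD_ge (η : ℝ → ℝ) (hη : IsBump η) (p : ℝ) (hp : 1 ≤ p) :
    ∃ C : ℝ≥0∞, C ≠ ∞ ∧ ∀ (f : SchwartzMap (EuclideanSpace ℝ (Fin (m+1))) ℂ) (k j : ℕ),
      ∫⁻ x, ‖DD η f k j x‖ₑ ^ p ≤
        C * ENNReal.ofReal (2 ^ j) * ∫⁻ z, ‖dyadicBox η j f z‖ₑ ^ p := by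
  obtain ⟨C, hC, H⟩ := trace_lint (m := m) η hη p (by linarith)
  obtain ⟨A, hA, HA⟩ := kS_lint m η hη 1 one_pos le_rfl
  simp only [sub_self, mul_zero, ENNReal.rpow_zero, mul_one, ENNReal.rpow_one] at HA
  refine ⟨A ^ (p-1) * A * C, ENNReal.mul_ne_top (ENNReal.mul_ne_top
    (ENNReal.rpow_ne_top_of_nonneg (by linarith) hA) hA) hC, fun f k j => ?_⟩
  have hkc := (kS m η hη k).continuous
  have hgc := tr_box_cont η hη f j
  have h1 : ∀ x, ‖DD η f k j x‖ₑ ^ p ≤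
      A ^ (p - 1) * ∫⁻ y, ‖kS m η hη k (x - y)‖ₑ * ‖dyadicBox η j f (emb y 0)‖ₑ ^ p := by
    intro x
    rw [DD_conv η hη]
    calc _ ≤ (∫⁻ y, ‖kS m η hη k (x - y)‖ₑ * ‖dyadicBox η j f (emb y 0)‖ₑ) ^ p := by
          gcongr
          exact conv_enorm_le (⇑(kS m η hη k)) (fun y => dyadicBox η j f (emb y 0)) x
      _ ≤ (∫⁻ y, ‖kS m η hη k (x - y)‖ₑ) ^ (p - 1) *
          ∫⁻ y, ‖kS m η hη k (x - y)‖ₑ * ‖dyadicBox η j f (emb y 0)‖ₑ ^ p := by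
          apply jensen_lint _ _ _ _ _ p hp
          · exact (hkc.comp (continuous_const.sub continuous_id)).enorm.measurable.aemeasurable
          · exact hgc.enorm.measurable.aemeasurable
      _ ≤ _ := by
          gcongr
          rw [lintegral_sub_left_eq_self (fun y => ‖kS m η hη k y‖ₑ)]
          exact HA k
  calc _ ≤ ∫⁻ x, A ^ (p - 1) * ∫⁻ y, ‖kS m η hη k (x - y)‖ₑ * ‖dyadicBox η j f (emb y 0)‖ₑ ^ p :=
        lintegral_mono h1
    _ = A ^ (p - 1) * ((∫⁻ x, ‖kS m η hη k x‖ₑ) * ∫⁻ y, ‖dyadicBox η j f (emb y 0)‖ₑ ^ p) := by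
        rw [lintegral_const_mul' _ _ (ENNReal.rpow_ne_top_of_nonneg (by linarith) hA),
          lint_conv (fun x => ‖kS m η hη k x‖ₑ) (fun y => ‖dyadicBox η j f (emb y 0)‖ₑ ^ p)
            hkc.enorm.measurable (hgc.enorm.measurable.pow_const p)]
    _ ≤ A ^ (p - 1) * (A * (C * ENNReal.ofReal (2 ^ j) * ∫⁻ z, ‖dyadicBox η j f z‖ₑ ^ p)) := by
        gcongr
        · exact HA k
        · exact H f j
    _ = _ := by ring

lemma prod_rep (η : ℝ → ℝ) (hη : IsBump η) (f : SchwartzMap (EuclideanSpace ℝ (Fin (m+1))) ℂ) (k j : ℕ)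
    (x y : EuclideanSpace ℝ (Fin m)) :
    kS m η hη k (x - y) * dyadicBox η j f (emb y 0) =
      expRep ((volume : Measure (EuclideanSpace ℝ (Fin m))).prod
        (volume : Measure (EuclideanSpace ℝ (Fin (m+1))))) (fun z => prj z.2 - z.1)
        (fun z => (Real.fourierChar (inner ℝ x z.1) • lpS m η hη k z.1) * GG η f j z.2) y := by
  rw [kS_eq_expRep, box_emb, expRep, expRep, ← integral_prod_mul]
  congr 1
  ext z
  have e1 : inner ℝ z.1 (x - y) = inner ℝ x z.1 + -inner ℝ y z.1 := by
    rw [real_inner_comm, inner_sub_left, sub_eq_add_neg]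
  have e2 : inner ℝ y (prj z.2 - z.1) = inner ℝ y (prj z.2) + -inner ℝ y z.1 := by
    rw [inner_sub_right, sub_eq_add_neg]
  rw [e1, e2]
  simp only [AddChar.map_add_eq_mul, Circle.smul_def, smul_eq_mul]
  push_cast
  ring

lemma DD_le (η : ℝ → ℝ) (hη : IsBump η) (p : ℝ) (hp : 0 < p) (hp1 : p ≤ 1) :
    ∃ C : ℝ≥0∞, C ≠ ∞ ∧ ∀ (f : SchwartzMap (EuclideanSpace ℝ (Fin (m+1))) ℂ) (k j : ℕ), k ≤ j + 1 →
      ∫⁻ x, ‖DD η f k j x‖ₑ ^ p ≤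
        C * (ENNReal.ofReal (2 ^ j) ^ ((m:ℝ) * (1 - p)) * ENNReal.ofReal (2 ^ k) ^ ((m:ℝ) * (p - 1)) *
          ENNReal.ofReal (2 ^ j)) * ∫⁻ z, ‖dyadicBox η j f z‖ₑ ^ p := by
  obtain ⟨C, hC, H⟩ := trace_lint (m := m) η hη p hp
  obtain ⟨A, hA, HA⟩ := kS_lint m η hη p hp hp1
  obtain ⟨N, hN, HN⟩ := nikol_one (V := EuclideanSpace ℝ (Fin m)) η hη p hp hp1
  simp only [finrank_euclideanSpace_fin] at HN
  have hmp : 0 ≤ (m:ℝ) * (1 - p) := mul_nonneg (by positivity) (by linarith)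
  have h8 : ENNReal.ofReal 8 ^ ((m:ℝ) * (1 - p)) ≠ ∞ :=
    ENNReal.rpow_ne_top_of_nonneg hmp (by simp)
  refine ⟨N * ENNReal.ofReal 8 ^ ((m:ℝ) * (1 - p)) * A * C, ENNReal.mul_ne_top (ENNReal.mul_ne_top
    (ENNReal.mul_ne_top hN h8) hA) hC, fun f k j hkj => ?_⟩
  have hkc := (kS m η hη k).continuous
  have hgc := tr_box_cont η hη f j
  set Q : ℝ≥0∞ := N * ENNReal.ofReal (8 * 2 ^ j) ^ ((m:ℝ) * (1 - p)) with hQ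
  have hQt : Q ≠ ∞ :=
    ENNReal.mul_ne_top hN (ENNReal.rpow_ne_top_of_nonneg hmp ENNReal.ofReal_ne_top)
  have h1 : ∀ x, ‖DD η f k j x‖ₑ ^ p ≤
      Q * ∫⁻ y, ‖kS m η hη k (x - y)‖ₑ ^ p * ‖dyadicBox η j f (emb y 0)‖ₑ ^ p := by
    intro x
    rw [DD_conv η hη]
    have hai : Integrable (fun z : EuclideanSpace ℝ (Fin m) × EuclideanSpace ℝ (Fin (m+1)) =>
        (Real.fourierChar (inner ℝ x z.1) • lpS m η hη k z.1) * GG η f j z.2)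
        ((volume : Measure (EuclideanSpace ℝ (Fin m))).prod
        (volume : Measure (EuclideanSpace ℝ (Fin (m+1))))) := by
      refine Integrable.mul_prod (f := fun ζ => Real.fourierChar (inner ℝ x ζ) • lpS m η hη k ζ) ?_
        (GG_int η hη f j)
      exact char_int volume _ (measurable_const.inner measurable_id) _ (lpS m η hη k).integrable
    have := HN (8 * 2 ^ j) (by positivity) (fun y => kS m η hη k (x - y) * dyadicBox η j f (emb y 0))
      _ hai.2.ne (by
        intro y
        rw [prod_rep]
        exact expRep_bound _ _ _ _)
      (by
        intro y
        simp only [prod_rep]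
        apply expRep_repro _ _ _ _ hai
        · intro z hz
          have hz1 := left_ne_zero_of_mul hz
          have hz2 := GG_supp η hη f j _ (right_ne_zero_of_mul hz)
          have hz3 : ‖z.1‖ < 2 ^ (k+1) := by
            apply lw_supp η hη k
            intro h0
            apply hz1
            rw [lpS_apply, h0]; simp
          have h4 := norm_prj_le z.2
          have h5 : (2:ℝ) ^ (k+1) ≤ 2 ^ (j+1+1) := pow_le_pow_right₀ (by norm_num) (by omega)
          have h6 := norm_sub_le (prj z.2) z.1
          have h7 : (2:ℝ) ^ (j+1+1) = 4 * 2 ^ j := by ring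
          have h8 : (2:ℝ) ^ (j+1) = 2 * 2 ^ j := by ring
          have h9 : (0:ℝ) < 2 ^ j := by positivity
          linarith
        · exact (prj_cont.measurable.comp measurable_snd).sub measurable_fst)
    calc _ ≤ (∫⁻ y, ‖kS m η hη k (x - y) * dyadicBox η j f (emb y 0)‖ₑ) ^ p := by
          gcongr
          exact enorm_integral_le_lintegral_enorm _
      _ ≤ _ := this
      _ = _ := by
          congr 1
          congr 1
          ext y
          rw [enorm_mul, ENNReal.mul_rpow_of_nonneg _ _ hp.le]
  calc _ ≤ ∫⁻ x, Q * ∫⁻ y, ‖kS m η hη k (x - y)‖ₑ ^ p * ‖dyadicBox η j f (emb y 0)‖ₑ ^ p :=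
        lintegral_mono h1
    _ = Q * ((∫⁻ x, ‖kS m η hη k x‖ₑ ^ p) * ∫⁻ y, ‖dyadicBox η j f (emb y 0)‖ₑ ^ p) := by
        rw [lintegral_const_mul' _ _ hQt,
          lint_conv (fun x => ‖kS m η hη k x‖ₑ ^ p) (fun y => ‖dyadicBox η j f (emb y 0)‖ₑ ^ p)
            (hkc.enorm.measurable.pow_const p) (hgc.enorm.measurable.pow_const p)]
    _ ≤ Q * ((A * ENNReal.ofReal (2 ^ k) ^ ((m : ℝ) * (p - 1))) *
          (C * ENNReal.ofReal (2 ^ j) * ∫⁻ z, ‖dyadicBox η j f z‖ₑ ^ p)) := by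
        gcongr
        · exact HA k
        · exact H f j
    _ = _ := by
        rw [hQ, ENNReal.ofReal_mul (by positivity), ENNReal.mul_rpow_of_nonneg _ _ hmp]
        ring

lemma DD_top (η : ℝ → ℝ) (hη : IsBump η) :
    ∃ C : ℝ≥0∞, C ≠ ∞ ∧ ∀ (f : SchwartzMap (EuclideanSpace ℝ (Fin (m+1))) ℂ) (k j : ℕ),
      eLpNorm (DD η f k j) ∞ volume ≤ C * eLpNorm (dyadicBox η j f) ∞ volume := by
  obtain ⟨A, hA, HA⟩ := kS_lint m η hη 1 one_pos le_rfl
  simp only [sub_self, mul_zero, ENNReal.rpow_zero, mul_one, ENNReal.rpow_one] at HA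
  refine ⟨A, hA, fun f k j => ?_⟩
  have hkc := (kS m η hη k).continuous
  set M := eLpNorm (dyadicBox η j f) ∞ volume with hM
  have hb : ∀ z, ‖dyadicBox η j f z‖ₑ ≤ M := by
    intro z
    have hae : ∀ᵐ z, ‖dyadicBox η j f z‖ₑ ≤ M := by
      rw [hM, eLpNorm_exponent_top]; exact enorm_ae_le_eLpNormEssSup _ _
    have hcl : IsClosed {z | ‖dyadicBox η j f z‖ₑ ≤ M} :=
      isClosed_le (box_cont η hη f j).enorm continuous_const
    have hd := Measure.dense_of_ae hae
    have := hcl.closure_eq ▸ hd.closure_eq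
    exact (this ▸ Set.mem_univ z : z ∈ {z | ‖dyadicBox η j f z‖ₑ ≤ M})
  rw [eLpNorm_exponent_top]
  apply eLpNormEssSup_le_of_ae_enorm_bound
  refine Filter.Eventually.of_forall fun x => ?_
  rw [DD_conv η hη]
  calc _ ≤ ∫⁻ y, ‖kS m η hη k (x - y)‖ₑ * ‖dyadicBox η j f (emb y 0)‖ₑ :=
        conv_enorm_le (⇑(kS m η hη k)) (fun y => dyadicBox η j f (emb y 0)) x
    _ ≤ ∫⁻ y, ‖kS m η hη k (x - y)‖ₑ * M := by
        gcongr; exact hb _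
    _ = (∫⁻ y, ‖kS m η hη k y‖ₑ) * M := by
        rw [lintegral_mul_const (f := fun y => ‖kS m η hη k (x - y)‖ₑ) _
          (hkc.comp (continuous_const.sub continuous_id)).enorm.measurable,
          lintegral_sub_left_eq_self (fun y => ‖kS m η hη k y‖ₑ)]
    _ ≤ _ := by gcongr; exact HA k

lemma DD_key (η : ℝ → ℝ) (hη : IsBump η) (p : ℝ≥0∞) (hp : 0 < p) (sp : ℝ)
    (hsp : sp = m * (1 / (min p 1).toReal - 1)) :
    ∃ C : ℝ≥0∞, C ≠ ∞ ∧ ∀ (f : SchwartzMap (EuclideanSpace ℝ (Fin (m+1))) ℂ) (k j : ℕ),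
      eLpNorm (DD η f k j) p volume ≤ C * ENNReal.ofReal ((2:ℝ) ^ (-((k:ℝ) * sp))) *
        (ENNReal.ofReal ((2:ℝ) ^ ((j:ℝ) * (sp + 1 / p.toReal))) *
          eLpNorm (dyadicBox η j f) p volume) := by
  rcases eq_or_ne p ∞ with rfl | hpt
  · obtain ⟨C, hC, H⟩ := DD_top (m := m) η hη
    have : sp = 0 := by rw [hsp]; simp
    subst this
    refine ⟨C, hC, fun f k j => ?_⟩
    simpa using H f k j
  have hP : 0 < p.toReal := ENNReal.toReal_pos hp.ne' hpt
  -- lintegral form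
  have key : ∃ C : ℝ≥0∞, C ≠ ∞ ∧ ∀ (f : SchwartzMap (EuclideanSpace ℝ (Fin (m+1))) ℂ) (k j : ℕ),
      ∫⁻ x, ‖DD η f k j x‖ₑ ^ p.toReal ≤ C * ENNReal.ofReal ((2:ℝ) ^ (-((k:ℝ) * sp) * p.toReal)) *
        (ENNReal.ofReal ((2:ℝ) ^ ((j:ℝ) * (sp + 1 / p.toReal) * p.toReal)) *
        ∫⁻ z, ‖dyadicBox η j f z‖ₑ ^ p.toReal) := by
    rcases le_total p 1 with h1 | h1
    · have hP1 : p.toReal ≤ 1 := by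
        rw [← ENNReal.toReal_one]; exact ENNReal.toReal_mono (by simp) h1
      obtain ⟨C, hC, H⟩ := DD_le (m := m) η hη p.toReal hP hP1
      refine ⟨C, hC, fun f k j => ?_⟩
      rcases le_or_gt k (j+1) with hkj | hkj
      · refine (H f k j hkj).trans (le_of_eq ?_)
        rw [min_eq_left h1] at hsp
        have hs : sp * p.toReal = m * (1 - p.toReal) := by rw [hsp]; field_simp
        have e1 : (j:ℝ) * (sp + 1 / p.toReal) * p.toReal = j * (m * (1 - p.toReal)) + j := by
          rw [← hs]; field_simp
        have e2 : -((k:ℝ) * sp) * p.toReal = k * (m * (p.toReal - 1)) := by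
          linear_combination (-(k:ℝ)) * hs
        have aux : ∀ (i : ℕ) (t : ℝ), ENNReal.ofReal ((2:ℝ) ^ ((i:ℝ) * t)) =
            ENNReal.ofReal (2 ^ i) ^ t := by
          intro i t
          rw [Real.rpow_mul (by norm_num), Real.rpow_natCast, ENNReal.ofReal_rpow_of_pos (by positivity)]
        rw [e1, e2, Real.rpow_add (by norm_num), ENNReal.ofReal_mul (by positivity),
          aux, aux, Real.rpow_natCast]
        ring
      · rw [DD_zero η hη f k j hkj]
        simp [hP]
    · have hP1 : 1 ≤ p.toReal := by
        rw [← ENNReal.toReal_one]; exact ENNReal.toReal_mono hpt h1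
      obtain ⟨C, hC, H⟩ := DD_ge (m := m) η hη p.toReal hP1
      refine ⟨C, hC, fun f k j => ?_⟩
      have hs : sp = 0 := by rw [hsp, min_eq_right h1]; simp
      subst hs
      have e1 : (j:ℝ) * (0 + 1 / p.toReal) * p.toReal = j := by field_simp; ring
      rw [e1]
      refine (H f k j).trans (le_of_eq ?_)
      simp [mul_assoc]
  obtain ⟨C, hC, H⟩ := key
  refine ⟨C ^ (1 / p.toReal), ENNReal.rpow_ne_top_of_nonneg (by positivity) hC, fun f k j => ?_⟩
  rw [eLpNorm_eq_lintegral_rpow_enorm_toReal hp.ne' hpt, eLpNorm_eq_lintegral_rpow_enorm_toReal hp.ne' hpt]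
  have hpos : 0 ≤ 1 / p.toReal := by positivity
  have aux : ∀ t : ℝ, ENNReal.ofReal ((2:ℝ) ^ (t * p.toReal)) ^ (1 / p.toReal) = ENNReal.ofReal (2 ^ t) := by
    intro t
    rw [ENNReal.ofReal_rpow_of_pos (by positivity), ← Real.rpow_mul (by norm_num)]
    congr 2
    field_simp
  calc _ ≤ _ := ENNReal.rpow_le_rpow (H f k j) hpos
    _ = _ := by
      rw [ENNReal.mul_rpow_of_nonneg _ _ hpos, ENNReal.mul_rpow_of_nonneg _ _ hpos,
        ENNReal.mul_rpow_of_nonneg _ _ hpos, aux, aux]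

end PartE


section PartF
variable {m : ℕ}

lemma rr_pos (p : ℝ≥0∞) (hp : 0 < p) : 0 < (min p 1).toReal :=
  ENNReal.toReal_pos (lt_min hp one_pos).ne' (ne_top_of_le_ne_top ENNReal.one_ne_top (min_le_right _ _))

lemma rr_le (p : ℝ≥0∞) : (min p 1).toReal ≤ 1 := by
  rw [← ENNReal.toReal_one]; exact ENNReal.toReal_mono (by simp) (min_le_right _ _)

lemma quasi_add {p : ℝ≥0∞} (hp : 0 < p) {u v : EuclideanSpace ℝ (Fin m) → ℂ}
    (hu : Continuous u) (hv : Continuous v) :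
    eLpNorm (u + v) p volume ^ (min p 1).toReal ≤
      eLpNorm u p volume ^ (min p 1).toReal + eLpNorm v p volume ^ (min p 1).toReal := by
  rcases le_total 1 p with h1 | h1
  · rw [min_eq_right h1]
    simpa using eLpNorm_add_le hu.aestronglyMeasurable hv.aestronglyMeasurable h1
  · have hpt : p ≠ ∞ := ne_top_of_le_ne_top ENNReal.one_ne_top h1
    have hr := rr_le p
    rw [min_eq_left h1] at hr ⊢
    have hP : 0 < p.toReal := ENNReal.toReal_pos hp.ne' hpt
    have e : ∀ w : EuclideanSpace ℝ (Fin m) → ℂ,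
        eLpNorm w p volume ^ p.toReal = ∫⁻ x, ‖w x‖ₑ ^ p.toReal := by
      intro w
      rw [eLpNorm_eq_lintegral_rpow_enorm_toReal hp.ne' hpt, ← ENNReal.rpow_mul,
        one_div_mul_cancel hP.ne', ENNReal.rpow_one]
    rw [e, e, e, ← lintegral_add_left (hu.enorm.measurable.pow_const _)]
    refine lintegral_mono fun x => ?_
    exact (ENNReal.rpow_le_rpow (enorm_add_le _ _) hP.le).trans
      (ENNReal.rpow_add_le_add_rpow _ _ hP.le hr)

lemma quasi_sum {p : ℝ≥0∞} (hp : 0 < p) (u : ℕ → EuclideanSpace ℝ (Fin m) → ℂ)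
    (hu : ∀ j, Continuous (u j)) (J : ℕ) :
    eLpNorm (fun x => ∑ j ∈ Finset.range J, u j x) p volume ^ (min p 1).toReal ≤
      ∑ j ∈ Finset.range J, eLpNorm (u j) p volume ^ (min p 1).toReal := by
  induction J with
  | zero => simp [rr_pos p hp]
  | succ J ih =>
    have hc : Continuous (fun x => ∑ j ∈ Finset.range J, u j x) :=
      continuous_finsetSum _ fun j _ => hu j
    have e : (fun x => ∑ j ∈ Finset.range (J+1), u j x) =
        (fun x => ∑ j ∈ Finset.range J, u j x) + u J := by
      ext x; simp [Finset.sum_range_succ]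
    rw [e, Finset.sum_range_succ]
    exact (quasi_add hp hc (hu J)).trans (by gcongr)

lemma lq_embed (a : ℕ → ℝ≥0∞) (ρ r : ℝ) (hρ : 0 < ρ) (hr : ρ ≤ r) :
    (∑' j, a j ^ r) ^ (1 / r) ≤ (∑' j, a j ^ ρ) ^ (1 / ρ) := by
  have hr0 : 0 < r := by linarith
  set S := ∑' j, a j ^ ρ with hS
  have h1 : ∀ j, a j ^ r ≤ a j ^ ρ * S ^ ((r - ρ) / ρ) := by
    intro j
    have hle : a j ^ ρ ≤ S := ENNReal.le_tsum j
    calc a j ^ r = a j ^ ρ * (a j ^ ρ) ^ ((r - ρ) / ρ) := by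
          rw [← ENNReal.rpow_mul, ← ENNReal.rpow_add_of_nonneg _ _ hρ.le]
          · congr 1; field_simp; ring
          · rw [mul_div_cancel₀ _ hρ.ne']; linarith
      _ ≤ _ := by
          gcongr
  have h2 : ∑' j, a j ^ r ≤ S ^ (r / ρ) := by
    calc _ ≤ ∑' j, a j ^ ρ * S ^ ((r - ρ) / ρ) := ENNReal.tsum_le_tsum h1
      _ = S ^ (1:ℝ) * S ^ ((r - ρ) / ρ) := by rw [ENNReal.tsum_mul_right, ENNReal.rpow_one]
      _ = _ := by
        rw [← ENNReal.rpow_add_of_nonneg _ _ zero_le_one (div_nonneg (by linarith) hρ.le)]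
        congr 1; field_simp; ring
  calc _ ≤ (S ^ (r / ρ)) ^ (1 / r) := ENNReal.rpow_le_rpow h2 (by positivity)
    _ = _ := by rw [← ENNReal.rpow_mul]; congr 1; field_simp

lemma trace_piece (η : ℝ → ℝ) (hη : IsBump η) (p : ℝ≥0∞) (hp : 0 < p) (sp : ℝ)
    (hsp : sp = m * (1 / (min p 1).toReal - 1)) :
    ∃ C : ℝ≥0∞, C ≠ ∞ ∧ ∀ (f : SchwartzMap (EuclideanSpace ℝ (Fin (m+1))) ℂ) (k : ℕ),
      eLpNorm (dyadicBox η k (traceFn ⇑f)) p volume ≤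
        C * ENNReal.ofReal ((2:ℝ) ^ (-((k:ℝ) * sp))) *
        (∑' j : ℕ, (ENNReal.ofReal ((2:ℝ) ^ ((j:ℝ) * (sp + 1 / p.toReal))) *
          eLpNorm (dyadicBox η j f) p volume) ^ (min p 1).toReal) ^ (1 / (min p 1).toReal) := by
  obtain ⟨C, hC, H⟩ := DD_key (m := m) η hη p hp sp hsp
  refine ⟨C, hC, fun f k => ?_⟩
  have hr := rr_pos p hp
  set r := (min p 1).toReal with hrdef
  refine Lp.eLpNorm_le_of_ae_tendsto (u := Filter.atTop)
    (f := fun J x => ∑ j ∈ Finset.range (J+1), DD η f k j x)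
    (Filter.Eventually.of_forall fun J => ?_)
    (fun J => (continuous_finsetSum _ fun j _ => DD_cont η hη f k j).aestronglyMeasurable)
    (Filter.Eventually.of_forall fun x => DD_tendsto η hη f k x)
  rw [← ENNReal.rpow_le_rpow_iff hr]
  refine (quasi_sum hp (DD η f k) (fun j => DD_cont η hη f k j) (J+1)).trans ?_
  rw [ENNReal.mul_rpow_of_nonneg _ _ hr.le, ← ENNReal.rpow_mul, one_div_mul_cancel hr.ne',
    ENNReal.rpow_one, ← ENNReal.tsum_mul_left]
  refine le_trans (Finset.sum_le_sum fun j _ => ?_) (ENNReal.sum_le_tsum _)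
  rw [← ENNReal.mul_rpow_of_nonneg _ _ hr.le]
  exact ENNReal.rpow_le_rpow (H f k j) hr.le

lemma geom_fin (t q : ℝ) (ht : t < 0) (hq : 0 < q) :
    (∑' k : ℕ, ENNReal.ofReal ((2:ℝ) ^ ((k:ℝ) * t)) ^ q) ≠ ∞ := by
  have e : ∀ k : ℕ, ENNReal.ofReal ((2:ℝ) ^ ((k:ℝ) * t)) ^ q = ENNReal.ofReal ((2:ℝ) ^ (t * q)) ^ k := by
    intro k
    rw [ENNReal.ofReal_rpow_of_pos (by positivity), ← Real.rpow_mul (by norm_num),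
      ← ENNReal.ofReal_pow (by positivity), ← Real.rpow_natCast, ← Real.rpow_mul (by norm_num)]
    congr 2; ring
  simp_rw [e]
  rw [ENNReal.tsum_geometric]
  apply ENNReal.inv_ne_top.2
  apply (tsub_pos_of_lt _).ne'
  rw [← ENNReal.ofReal_one]
  apply (ENNReal.ofReal_lt_ofReal_iff one_pos).2
  exact Real.rpow_lt_one_of_one_lt_of_neg (by norm_num) (mul_neg_of_neg_of_pos ht hq)

lemma lqSum_geom (q : ℝ≥0∞) (hq : 0 < q) (t : ℝ) (ht : t < 0) :
    ∃ G : ℝ≥0∞, G ≠ ∞ ∧ ∀ (b : ℕ → ℝ≥0∞) (B : ℝ≥0∞),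
      (∀ k : ℕ, b k ≤ ENNReal.ofReal ((2:ℝ) ^ ((k:ℝ) * t)) * B) → lqSum q b ≤ G * B := by
  rcases eq_or_ne q ∞ with rfl | hqt
  · refine ⟨1, by simp, fun b B h => ?_⟩
    rw [lqSum, if_pos rfl]
    refine iSup_le fun k => (h k).trans ?_
    gcongr
    rw [← ENNReal.ofReal_one]
    apply ENNReal.ofReal_le_ofReal
    exact Real.rpow_le_one_of_one_le_of_nonpos (by norm_num)
      (mul_nonpos_of_nonneg_of_nonpos (by positivity) ht.le)
  · have hQ : 0 < q.toReal := ENNReal.toReal_pos hq.ne' hqt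
    have hQ' : 0 ≤ 1 / q.toReal := by positivity
    refine ⟨(∑' k : ℕ, ENNReal.ofReal ((2:ℝ) ^ ((k:ℝ) * t)) ^ q.toReal) ^ (1 / q.toReal),
      ENNReal.rpow_ne_top_of_nonneg hQ' (geom_fin t _ ht hQ), fun b B h => ?_⟩
    rw [lqSum, if_neg hqt]
    calc _ ≤ ((∑' k : ℕ, ENNReal.ofReal ((2:ℝ) ^ ((k:ℝ) * t)) ^ q.toReal) * B ^ q.toReal)
          ^ (1 / q.toReal) := by
          apply ENNReal.rpow_le_rpow _ hQ'
          rw [← ENNReal.tsum_mul_right]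
          refine ENNReal.tsum_le_tsum fun k => ?_
          rw [← ENNReal.mul_rpow_of_nonneg _ _ hQ.le]
          exact ENNReal.rpow_le_rpow (h k) hQ.le
      _ = _ := by
          rw [ENNReal.mul_rpow_of_nonneg _ _ hQ', ← ENNReal.rpow_mul B, mul_one_div_cancel hQ.ne',
            ENNReal.rpow_one]

end PartF

/-- For `n = m+1 ≥ 2`, `0 < p, q ≤ ∞`, `s_p = (n-1)(1/min(p,1) - 1)` and
`s < s_p`, the trace satisfies
`‖Tr f‖_{B^{s}_{p,q}(ℝ^{n-1})} ≤ C ‖f‖_{B^{s_p+1/p}_{p,min(p,q,1)}(ℝⁿ)}`. -/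
theorem trace_besov_below_limit_bound
    (m : ℕ) (hm : 1 ≤ m) (η : ℝ → ℝ) (hη : IsBump η)
    (p q : ℝ≥0∞) (hp : 0 < p) (hq : 0 < q) (sp s : ℝ)
    (hsp : sp = m * (1 / (min p 1).toReal - 1)) (hs : s < sp) :
    ∃ C : ℝ≥0∞, 0 < C ∧ C ≠ ∞ ∧
      ∀ f : SchwartzMap (EuclideanSpace ℝ (Fin (m+1))) ℂ,
        besovNorm η s p q (traceFn (⇑f)) ≤
          C * besovNorm η (sp + 1 / p.toReal) p (min p (min q 1)) (⇑f) := by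
  obtain ⟨C, hC, H⟩ := trace_piece (m := m) η hη p hp sp hsp
  obtain ⟨G, hG, HG⟩ := lqSum_geom q hq (s - sp) (by linarith)
  refine ⟨G * C + 1, by simp, ENNReal.add_ne_top.2 ⟨ENNReal.mul_ne_top hG hC, by simp⟩,
    fun f => ?_⟩
  have hle1 : min p (min q 1) ≤ min p 1 := min_le_min le_rfl (min_le_right _ _)
  have hm1 : min p 1 ≠ ∞ := ne_top_of_le_ne_top ENNReal.one_ne_top (min_le_right _ _)
  have hρt : min p (min q 1) ≠ ∞ := ne_top_of_le_ne_top hm1 hle1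
  have hρ : 0 < (min p (min q 1)).toReal :=
    ENNReal.toReal_pos (lt_min hp (lt_min hq one_pos)).ne' hρt
  have hρr : (min p (min q 1)).toReal ≤ (min p 1).toReal := ENNReal.toReal_mono hm1 hle1
  set R := besovNorm η (sp + 1 / p.toReal) p (min p (min q 1)) (⇑f) with hR
  have hRe : (∑' j : ℕ, (ENNReal.ofReal ((2:ℝ) ^ ((j:ℝ) * (sp + 1 / p.toReal))) *
      eLpNorm (dyadicBox η j f) p volume) ^ (min p 1).toReal) ^ (1 / (min p 1).toReal) ≤ R := by
    rw [hR, besovNorm, lqSum, if_neg hρt]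
    exact lq_embed _ _ _ hρ hρr
  have : besovNorm η s p q (traceFn (⇑f)) ≤ G * (C * R) := by
    rw [besovNorm]
    apply HG
    intro k
    calc _ ≤ ENNReal.ofReal ((2:ℝ) ^ ((k:ℝ) * s)) *
          (C * ENNReal.ofReal ((2:ℝ) ^ (-((k:ℝ) * sp))) * R) := by
          gcongr
          exact (H f k).trans (by gcongr)
      _ = (ENNReal.ofReal ((2:ℝ) ^ ((k:ℝ) * s)) * ENNReal.ofReal ((2:ℝ) ^ (-((k:ℝ) * sp)))) *
          (C * R) := by ring
      _ = _ := by
          rw [← ENNReal.ofReal_mul (by positivity), ← Real.rpow_add (by norm_num)]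
          congr 3; ring
  calc _ ≤ G * (C * R) := this
    _ = (G * C) * R := by ring
    _ ≤ _ := by gcongr; exact le_self_add
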